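/- Three-point Nevanlinna–Pick interpolation with real nodes: let r₁, r₂, r₃ ∈ (−1,1) ⊂ ℝ be pairwise distinct and let s₁, s₂, s₃ ∈ 𝔹. Set Q₁² := M_{r₁}(r₂)⁻¹·M_{s₁}(s₂) and Q₁³ := M_{r₁}(r₃)⁻¹·M_{s₁}(s₃). Then the interpolation problem f(r_m) = s_m for m = 1, 2, 3, with f a slice regular self-map of 𝔹, has infinitely many solutions if and only if ρ(s₁,s₂) < ρ(r₁,r₂), ρ(s₁,s₃) < ρ(r₁,r₃), and ρ(Q₁², Q₁³) < ρ(r₂,r₃). Moreover, if ρ(s₁,s₂) < ρ(r₁,r₂) and ρ(s₁,s₃) < ρ(r₁,r₃) but ρ(Q₁², Q₁³) = ρ(r₂,r₃), then the problem has exactly one solution. -/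

import Mathlib

noncomputable section

abbrev H : Type := Quaternion ℝ

namespace QPaper

/-- The complex slice determined by `I`: the real span of `1` and `I`. -/
def sliceSet (I : H) : Set H := {q | ∃ x y : ℝ, q = (x : H) + y • I}

/-- Evaluation of the power series `q ↦ ∑ qᵐ aₘ` with right coefficients. -/
def evalC (a : ℕ → H) (q : H) : H := ∑' m, q ^ m * a m

/-- The series with coefficients `a` converges at every point of the unit ball. -/
def SummableOn (a : ℕ → H) : Prop := ∀ q : H, ‖q‖ < 1 → Summable fun m => q ^ m * a m

/-- `a` are the coefficients of a slice regular self-map of the unit ball. -/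
def SelfMap (a : ℕ → H) : Prop :=
  SummableOn a ∧ ∀ q : H, ‖q‖ < 1 → ‖evalC a q‖ < 1

/-- Coefficients of the ∗-product. -/
def starMulC (a b : ℕ → H) : ℕ → H := fun m => ∑ ℓ ∈ Finset.range (m + 1), a (m - ℓ) * b ℓ

/-- Coefficients of the ∗-inverse (of a series with invertible constant term). -/
def starInvC (a : ℕ → H) : ℕ → H
  | 0 => (a 0)⁻¹
  | m + 1 => -(a 0)⁻¹ * ∑ ℓ : Fin (m + 1), a (m + 1 - ℓ.val) * starInvC a ℓ.val
  decreasing_by exact ℓ.isLt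

/-- Coefficients of `1 - q p̄`. -/
def oneMinusQPbarC (p : H) : ℕ → H := fun m => if m = 0 then 1 else if m = 1 then -(star p) else 0

/-- Coefficients of `q - p`. -/
def qMinusPC (p : H) : ℕ → H := fun m => if m = 0 then -p else if m = 1 then 1 else 0

/-- Coefficients of the regular Möbius transformation `ℳ_p = (1 - q p̄)^{-∗} ∗ (q - p)`. -/
def mobiusC (p : H) : ℕ → H := starMulC (starInvC (oneMinusQPbarC p)) (qMinusPC p)

/-- Coefficients of `ℳ_{t₁} ∗ ⋯ ∗ ℳ_{t_κ}`. -/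
def blaschkeListC : List H → (ℕ → H)
  | [] => fun m => if m = 0 then 1 else 0
  | t :: ts => starMulC (mobiusC t) (blaschkeListC ts)

/-- `a` are the coefficients of a regular Blaschke product of degree `κ`,
i.e. of `ℳ_{t₁} ∗ ⋯ ∗ ℳ_{t_κ} u` with the `tᵢ` in `𝔹` and `u` unimodular. -/
def IsBlaschke (a : ℕ → H) (κ : ℕ) : Prop :=
  ∃ (ts : List H) (u : H), ts.length = κ ∧ (∀ t ∈ ts, ‖t‖ < 1) ∧ ‖u‖ = 1 ∧
    a = fun m => blaschkeListC ts m * u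

/-- Coefficients of `ℳ_w ∙ f = (1 - f w̄)^{-∗} ∗ (f - w)`. -/
def bulletC (w : H) (a : ℕ → H) : ℕ → H :=
  starMulC (starInvC (fun m => (if m = 0 then (1 : H) else 0) - a m * star w))
    (fun m => a m - if m = 0 then w else 0)

/-- Coefficients of the regular difference quotient `ℛ_{f,p}`,
the unique slice regular function with `f(q) = f(p) + (q - p) ∗ ℛ_{f,p}(q)`. -/
def diffQuotC (a : ℕ → H) (p : H) : ℕ → H := fun m => ∑' k, p ^ k * a (k + m + 1)

/-- Coefficients of the hyperbolic difference quotient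
`f⋆_p = (1 - q p̄) ∗ ℛ_{f,p} ∗ (1 - \overline{f(p)} f)^{-∗} = ℳ_p^{-∗} ∗ (ℳ_{f(p)} ∙ f)`. -/
def hdqC (a : ℕ → H) (p : H) : ℕ → H :=
  starMulC (starMulC (oneMinusQPbarC p) (diffQuotC a p))
    (starInvC (fun m => (if m = 0 then (1 : H) else 0) - star (evalC a p) * a m))

/-- Iterated hyperbolic difference quotients: `ihdqC a [p₁, …, pₙ] = ((f⋆_{p₁})⋆_{p₂} ⋯)⋆_{pₙ}`. -/
def ihdqC (a : ℕ → H) : List H → (ℕ → H)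
  | [] => a
  | p :: ps => ihdqC (hdqC a p) ps

/-- `𝒯_p(q) = (1 - q p)⁻¹ q (1 - q p)`. -/
def mobiusT (p q : H) : H := (1 - q * p)⁻¹ * q * (1 - q * p)

/-- `M_p(q) = (1 - q p̄)⁻¹ (q - p)`. -/
def mobiusM (p q : H) : H := (1 - q * star p)⁻¹ * (q - p)

/-- Pointwise evaluation of the regular Möbius transformation: `ℳ_p(q) = M_p(𝒯_p(q))`. -/
def mobiusEval (p q : H) : H := mobiusM p (mobiusT p q)

/-- The pseudo-hyperbolic distance `ρ(p,q) = |M_p(q)|`. -/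
def rho (p q : H) : ℝ := ‖mobiusM p q‖

/-- The Poincaré distance `δ(p,q) = tanh⁻¹ ρ(p,q) = ½ log((1+ρ)/(1−ρ))`. -/
def pdist (p q : H) : ℝ := (1/2 : ℝ) * Real.log ((1 + rho p q) / (1 - rho p q))


section Aux
open Metric Set Filter Topology

/-- `ℍ` as a complex normed space (left multiplication by `ℂ = ℝ + ℝ i`). -/
@[reducible] def modC : Module ℂ H := Module.compHom H (Quaternion.ofComplex : ℂ →ₐ[ℝ] H).toRingHom

attribute [local instance 50] modC

lemma csmul_def (z : ℂ) (v : H) : z • v = (z : H) * v := rfl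

lemma norm_cc (z : ℂ) : ‖(z : H)‖ = ‖z‖ := by
  have h1 := Quaternion.normSq_eq_norm_mul_self (z : H)
  have h2 := Complex.normSq_eq_norm_sq z
  rw [Quaternion.normSq_def'] at h1
  rw [Complex.normSq_apply] at h2
  simp at h1
  have : ‖(z : H)‖ ^ 2 = ‖z‖ ^ 2 := by nlinarith
  exact (sq_eq_sq₀ (norm_nonneg _) (norm_nonneg _)).1 this

@[reducible] def nsC : NormedSpace ℂ H where
  norm_smul_le z v := by rw [csmul_def, norm_mul, norm_cc]

attribute [local instance 50] nsC

lemma cc_sub (z w : ℂ) : ((z - w : ℂ) : H) = (z : H) - w := by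
  ext <;> simp

lemma cc_pow (z : ℂ) (n : ℕ) : ((z ^ n : ℂ) : H) = (z : H) ^ n := by
  exact map_pow Quaternion.ofComplex z n

/-- The quaternion `j`. -/
def jj : H := ⟨0, 0, 1, 0⟩

/-- build a quaternion -/
def mkq (a b c d : ℝ) : H := ⟨a, b, c, d⟩

lemma jj_re : jj.re = 0 := rfl
lemma jj_imI : jj.imI = 0 := rfl
lemma jj_imJ : jj.imJ = 1 := rfl
lemma jj_imK : jj.imK = 0 := rfl
lemma mkq_re (a b c d : ℝ) : (mkq a b c d).re = a := rfl
lemma mkq_imI (a b c d : ℝ) : (mkq a b c d).imI = b := rfl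
lemma mkq_imJ (a b c d : ℝ) : (mkq a b c d).imJ = c := rfl
lemma mkq_imK (a b c d : ℝ) : (mkq a b c d).imK = d := rfl

lemma hs_congr {f g : ℕ → H} {s : H} (h : HasSum f s) (e : ∀ n, g n = f n) : HasSum g s :=
  (funext e : g = f) ▸ h

lemma jj_mul (z : ℂ) : jj * (z : H) = ((starRingEnd ℂ z : ℂ) : H) * jj := by
  ext <;> simp [jj_re, jj_imI, jj_imJ, jj_imK]

lemma decomp (v : H) : v = ((⟨v.re, v.imI⟩ : ℂ) : H) + ((⟨v.imJ, v.imK⟩ : ℂ) : H) * jj := by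
  ext <;> simp [jj_re, jj_imI, jj_imJ, jj_imK]

lemma scs : @StrictConvexSpace ℝ H _ _ _ NormedSpace.complexToReal := by
  have h0 : @StrictConvexSpace ℝ H _ _ _ (inferInstanceAs (NormedSpace ℝ (Quaternion ℝ))) :=
    inferInstance
  refine @StrictConvexSpace.of_norm_add_ne_two H _ NormedSpace.complexToReal ?_
  intro x y hx hy hne h
  have h1 := @norm_add_lt_of_not_sameRay H _ _ h0 x y
  apply hne
  by_contra hne
  have := h1 (fun hs => hne (SameRay.eq_of_norm_eq hs (hx.trans hy.symm)))
  rw [hx, hy, h] at this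
  norm_num at this

/-- Right multiplication. -/
def Rm (w : H) : H →L[ℂ] H := LinearMap.mkContinuous
  { toFun := fun v => v * w
    map_add' := fun x y => add_mul x y w
    map_smul' := fun z x => mul_assoc (z : H) x w } ‖w‖
  (fun v => by change ‖v * w‖ ≤ ‖w‖ * ‖v‖; rw [norm_mul, mul_comm])

@[simp] lemma Rm_apply (w v : H) : Rm w v = v * w := rfl

lemma smulRm (z : ℂ) (w v : H) : (z • Rm w) v = (z : H) * (v * w) := rfl

lemma Rm_norm (w : H) : ‖Rm w‖ ≤ ‖w‖ := LinearMap.mkContinuous_norm_le _ (norm_nonneg _) _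

/-- every quaternion is conjugate to a complex number -/
lemma exists_conj (q : H) : ∃ (z : ℂ) (v : H), v ≠ 0 ∧ v * q = (z : H) * v := by
  by_cases h : q.imJ = 0 ∧ q.imK = 0
  · refine ⟨⟨q.re, q.imI⟩, 1, one_ne_zero, ?_⟩
    obtain ⟨h1, h2⟩ := h
    ext <;> simp [h1, h2]
  · set s := Real.sqrt (q.imI ^ 2 + q.imJ ^ 2 + q.imK ^ 2) with hs
    have hs2 : s ^ 2 = q.imI ^ 2 + q.imJ ^ 2 + q.imK ^ 2 := Real.sq_sqrt (by positivity)
    refine ⟨⟨q.re, s⟩, mkq (- q.imI - s) 0 (- q.imK) q.imJ, ?_, ?_⟩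
    · intro h0
      apply h
      have h1 : - q.imK = 0 := by
        rw [← mkq_imJ (- q.imI - s) 0 (- q.imK) q.imJ, h0]; rfl
      have h2 : q.imJ = 0 := by
        rw [← mkq_imK (- q.imI - s) 0 (- q.imK) q.imJ, h0]; rfl
      exact ⟨h2, by linarith⟩
    · ext <;> simp [mkq_re, mkq_imI, mkq_imJ, mkq_imK] <;> nlinarith

lemma norm_conj {q v : H} {z : ℂ} (hv : v ≠ 0) (h : v * q = (z : H) * v) : ‖q‖ = ‖z‖ := by
  have := congrArg norm h
  rw [norm_mul, norm_mul, norm_cc, mul_comm] at this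
  exact mul_right_cancel₀ (norm_ne_zero_iff.2 hv) this

lemma pow_conj {q v : H} {z : ℂ} (h : v * q = (z : H) * v) (m : ℕ) :
    v * q ^ m = (z : H) ^ m * v := by
  induction m with
  | zero => simp
  | succ n ih => rw [pow_succ, ← mul_assoc, ih, mul_assoc, h, ← mul_assoc, pow_succ]

lemma right_mult (T : H →L[ℂ] H) (hT : ∀ v, T (jj * v) = jj * T v) (v : H) : T v = v * T 1 := by
  have h1 : ∀ z : ℂ, T (z : H) = (z : H) * T 1 := by
    intro z
    have := T.map_smul z 1
    simpa [csmul_def] using this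
  have h2 : ∀ z : ℂ, T ((z : H) * jj) = (z : H) * jj * T 1 := by
    intro z
    have := T.map_smul z jj
    rw [csmul_def, csmul_def] at this
    rw [this, mul_assoc]
    have := hT 1
    rw [mul_one] at this
    rw [this]
  conv_lhs => rw [decomp v]
  conv_rhs => rw [decomp v]
  rw [map_add, h1, h2, add_mul]

/-- closed Schur class, coefficient form -/
def SB (a : ℕ → H) : Prop := SummableOn a ∧ ∀ q : H, ‖q‖ < 1 → ‖evalC a q‖ ≤ 1

/-- operator form -/
def opF (a : ℕ → H) (z : ℂ) : H →L[ℂ] H := ∑' m, z ^ m • Rm (a m)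

lemma summable_norm_real {a : ℕ → H} (ha : SummableOn a) {r : ℝ} (hr0 : 0 ≤ r) (hr : r < 1) :
    Summable fun m => r ^ m * ‖a m‖ := by
  have h := ha (r : H) (by rw [Quaternion.norm_coe, Real.norm_of_nonneg hr0]; exact hr)
  have h2 := h.norm
  simpa [norm_mul, norm_pow, Quaternion.norm_coe, abs_of_nonneg hr0] using h2

lemma opF_summable {a : ℕ → H} (ha : SummableOn a) {z : ℂ} (hz : ‖z‖ < 1) :
    Summable fun m => z ^ m • Rm (a m) := by
  refine Summable.of_norm_bounded (summable_norm_real ha (norm_nonneg z) hz) fun m => ?_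
  rw [norm_smul, norm_pow]
  gcongr
  exact Rm_norm _

lemma opF_apply {a : ℕ → H} (ha : SummableOn a) {z : ℂ} (hz : ‖z‖ < 1) {q v : H}
    (h : v * q = (z : H) * v) (hv : v ≠ 0) : opF a z v = v * evalC a q := by
  have h1 := (opF_summable ha hz).hasSum.mapL (ContinuousLinearMap.apply ℂ H v)
  have hq : ‖q‖ < 1 := by rw [norm_conj hv h]; exact hz
  have h2 := (ha q hq).hasSum.mul_left v
  refine h1.unique ?_
  refine hs_congr h2 fun m => ?_
  rw [ContinuousLinearMap.apply_apply, smulRm, cc_pow, ← mul_assoc, ← mul_assoc, pow_conj h]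

lemma opF_real {a : ℕ → H} (ha : SummableOn a) {x : ℝ} (hx : |x| < 1) (v : H) :
    opF a x v = v * evalC a x := by
  by_cases hv : v = 0
  · simp [hv]
  · refine opF_apply ha (by simpa using hx) ?_ hv
    rw [Quaternion.coeComplex_coe]
    exact (Quaternion.coe_commutes x v).symm

lemma opF_symm {a : ℕ → H} (ha : SummableOn a) {z : ℂ} (hz : ‖z‖ < 1) (v : H) :
    opF a (starRingEnd ℂ z) (jj * v) = jj * opF a z v := by
  have hz' : ‖starRingEnd ℂ z‖ < 1 := by simpa using hz
  have h1 := (opF_summable ha hz).hasSum.mapL (ContinuousLinearMap.apply ℂ H v)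
  have h2 := (opF_summable ha hz').hasSum.mapL (ContinuousLinearMap.apply ℂ H (jj * v))
  refine h2.unique ?_
  refine hs_congr (h1.mul_left jj) fun m => ?_
  rw [ContinuousLinearMap.apply_apply, ContinuousLinearMap.apply_apply, smulRm, smulRm,
    ← map_pow, ← mul_assoc jj (_ : H), jj_mul]
  simp only [mul_assoc]

lemma opF_diff {a : ℕ → H} (ha : SummableOn a) : DifferentiableOn ℂ (opF a) (ball 0 1) := by
  intro z hz
  have hz : ‖z‖ < 1 := by simpa using hz
  obtain ⟨r, hr1, hr2⟩ := exists_between hz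
  have hr0 : 0 ≤ r := (norm_nonneg z).trans hr1.le
  have : DifferentiableOn ℂ (opF a) (ball 0 r) := by
    refine Complex.differentiableOn_tsum_of_summable_norm (summable_norm_real ha hr0 hr2) ?_ isOpen_ball ?_
    · intro m
      fun_prop
    · intro m w hw
      have hw : ‖w‖ < r := by simpa using hw
      rw [norm_smul, norm_pow]
      gcongr
      exact Rm_norm _
  exact (this.differentiableAt (isOpen_ball.mem_nhds (by simpa using hr1))).differentiableWithinAt

/-- Operator Schur class -/
structure OS (F : ℂ → H →L[ℂ] H) : Prop where
  diff : DifferentiableOn ℂ F (ball 0 1)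
  symm : ∀ z : ℂ, ‖z‖ < 1 → ∀ v, F (starRingEnd ℂ z) (jj * v) = jj * F z v
  le : ∀ z : ℂ, ‖z‖ < 1 → ∀ v, ‖F z v‖ ≤ ‖v‖

lemma opF_le {a : ℕ → H} (ha : SB a) {z : ℂ} (hz : ‖z‖ < 1) (v : H) : ‖opF a z v‖ ≤ ‖v‖ := by
  by_cases hv : v = 0
  · simp [hv]
  · have h : v * (v⁻¹ * z * v) = (z : H) * v := by
      rw [← mul_assoc, ← mul_assoc, mul_inv_cancel₀ hv, one_mul]
    rw [opF_apply ha.1 hz h hv, norm_mul]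
    have := ha.2 (v⁻¹ * z * v) (by rw [norm_conj hv h]; exact hz)
    nlinarith [norm_nonneg v]

lemma opF_lt {a : ℕ → H} (ha : SelfMap a) {z : ℂ} (hz : ‖z‖ < 1) {v : H} (hv : v ≠ 0) :
    ‖opF a z v‖ < ‖v‖ := by
  have h : v * (v⁻¹ * z * v) = (z : H) * v := by
    rw [← mul_assoc, ← mul_assoc, mul_inv_cancel₀ hv, one_mul]
  rw [opF_apply ha.1 hz h hv, norm_mul]
  have := ha.2 (v⁻¹ * z * v) (by rw [norm_conj hv h]; exact hz)
  nlinarith [norm_pos_iff.2 hv]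

lemma SelfMap.sb {a : ℕ → H} (ha : SelfMap a) : SB a := ⟨ha.1, fun q hq => (ha.2 q hq).le⟩

lemma opF_OS {a : ℕ → H} (ha : SB a) : OS (opF a) :=
  ⟨opF_diff ha.1, fun _ hz v => opF_symm ha.1 hz v, fun _ hz v => opF_le ha hz v⟩

lemma OS.real {F : ℂ → H →L[ℂ] H} (hF : OS F) {x : ℝ} (hx : |x| < 1) (v : H) :
    F x v = v * F x 1 := by
  refine right_mult _ (fun v => ?_) v
  have := hF.symm x (by simpa using hx) v
  simpa using this

lemma fromOS {F : ℂ → H →L[ℂ] H} (hF : OS F) : ∃ a, SB a ∧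
    (∀ x : ℝ, |x| < 1 → evalC a x = F x 1) ∧
    ((∀ z : ℂ, ‖z‖ < 1 → ∀ v ≠ 0, ‖F z v‖ < ‖v‖) → SelfMap a) := by
  have hd : DifferentiableOn ℂ (fun z => F z 1) (ball 0 1) := by
    have := hF.diff
    intro z hz
    exact (this z hz).clm_apply (differentiableWithinAt_const _)
  set a : ℕ → H := fun n => ((n.factorial : ℂ)⁻¹) • iteratedDeriv n (fun z => F z 1) 0 with ha
  have key1 : ∀ z : ℂ, ‖z‖ < 1 → HasSum (fun n => (z : H) ^ n * a n) (F z 1) := by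
    intro z hz
    have := Complex.hasSum_taylorSeries_on_ball hd (z := z) (by simpa using hz)
    refine hs_congr this fun n => ?_
    rw [ha, ← cc_pow, ← csmul_def]
    simp only [sub_zero]
    rw [smul_comm]
  have key2 : ∀ z : ℂ, ‖z‖ < 1 → ∀ v : H, HasSum (fun n => (z : H) ^ n * (v * a n)) (F z v) := by
    intro z hz v
    have h1 := key1 z hz
    have h2 := key1 (starRingEnd ℂ z) (by simpa using hz)
    set α : ℂ := ⟨v.re, v.imI⟩
    set β : ℂ := ⟨v.imJ, v.imK⟩
    have hv : v = (α : H) + (β : H) * jj := decomp v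
    have hFv : F z v = (α : H) * F z 1 + (β : H) * (jj * F (starRingEnd ℂ z) 1) := by
      have e1 := (F z).map_smul α 1
      have e2 := (F z).map_smul β jj
      have e3 := hF.symm (starRingEnd ℂ z) (by simpa using hz) 1
      rw [csmul_def, csmul_def] at e1 e2
      rw [mul_one] at e1 e3
      rw [starRingEnd_self_apply] at e3
      rw [← e3, ← e1, ← e2, ← map_add, ← hv]
    rw [hFv]
    refine hs_congr ((h1.mul_left (α : H)).add ((h2.mul_left jj).mul_left (β : H))) fun n => ?_
    have c1 : (z : H) ^ n * (α : H) = (α : H) * (z : H) ^ n := by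
      rw [← cc_pow, ← Quaternion.coeComplex_mul, mul_comm, Quaternion.coeComplex_mul]
    have c2 : (z : H) ^ n * (β : H) = (β : H) * (z : H) ^ n := by
      rw [← cc_pow, ← Quaternion.coeComplex_mul, mul_comm, Quaternion.coeComplex_mul]
    have c3 : jj * ((starRingEnd ℂ z : ℂ) : H) ^ n = (z : H) ^ n * jj := by
      rw [← cc_pow, jj_mul, ← map_pow, starRingEnd_self_apply, cc_pow]
    rw [← mul_assoc jj, c3, hv]
    simp only [add_mul, mul_add, mul_assoc]
    rw [← mul_assoc _ (α : H), c1, ← mul_assoc _ (β : H), c2]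
    simp only [mul_assoc]
  have key3 : ∀ (q v : H) (z : ℂ), v ≠ 0 → v * q = (z : H) * v → ‖q‖ < 1 →
      HasSum (fun n => q ^ n * a n) (v⁻¹ * F z v) := by
    intro q v z hv h hq
    rw [norm_conj hv h] at hq
    refine hs_congr ((key2 z hq v).mul_left v⁻¹) fun n => ?_
    rw [← mul_assoc _ v, ← pow_conj h, mul_assoc v, ← mul_assoc, inv_mul_cancel₀ hv, one_mul]
  have hsum : SummableOn a := by
    intro q hq
    obtain ⟨z, v, hv, h⟩ := exists_conj q
    exact (key3 q v z hv h hq).summable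
  refine ⟨a, ⟨hsum, ?_⟩, ?_, ?_⟩
  · intro q hq
    obtain ⟨z, v, hv, h⟩ := exists_conj q
    rw [evalC, (key3 q v z hv h hq).tsum_eq, norm_mul, norm_inv]
    rw [norm_conj hv h] at hq
    have := hF.le z hq v
    rw [inv_mul_le_iff₀ (norm_pos_iff.2 hv), mul_one]
    exact this
  · intro x hx
    have := key1 x (by simpa using hx)
    rw [Quaternion.coeComplex_coe] at this
    exact this.tsum_eq
  · intro hs
    refine ⟨hsum, ?_⟩
    intro q hq
    obtain ⟨z, v, hv, h⟩ := exists_conj q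
    rw [evalC, (key3 q v z hv h hq).tsum_eq, norm_mul, norm_inv]
    rw [norm_conj hv h] at hq
    rw [inv_mul_lt_iff₀ (norm_pos_iff.2 hv), mul_one]
    exact hs z hq v hv

lemma uniq {a b : ℕ → H} (ha : SummableOn a) (hb : SummableOn b)
    (h : ∀ x : ℝ, |x| < 1 → evalC a x = evalC b x) : a = b := by
  have key : ∀ c : ℕ → H, SummableOn c → HasFPowerSeriesAt (fun x : ℝ => evalC c x)
      (fun n => ContinuousMultilinearMap.mkPiRing ℝ (Fin n) (c n)) 0 := by
    intro c hc
    refine hasFPowerSeriesAt_iff.2 ?_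
    filter_upwards [ball_mem_nhds (0 : ℝ) one_pos] with x hx
    have hx : |x| < 1 := by simpa using hx
    have := (hc (x : H) (by simpa using hx)).hasSum
    rw [zero_add]
    refine hs_congr this fun n => ?_
    simp [FormalMultilinearSeries.coeff]
    rw [← Quaternion.coe_mul_eq_smul]
    simp
  have h1 := key a ha
  have h2 := key b hb
  have h3 : HasFPowerSeriesAt (fun x : ℝ => evalC a x)
      (fun n => ContinuousMultilinearMap.mkPiRing ℝ (Fin n) (b n)) 0 := by
    refine h2.congr ?_
    filter_upwards [ball_mem_nhds (0 : ℝ) one_pos] with x hx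
    exact (h x (by simpa using hx)).symm
  have h4 := h1.eq_formalMultilinearSeries h3
  funext n
  have := congrFun h4 n
  exact ContinuousMultilinearMap.mkPiRing_eq_iff.1 this

lemma dich {b : ℕ → H} (hb : SB b) :
    SelfMap b ∨ ∃ u : H, ‖u‖ = 1 ∧ ∀ x : ℝ, |x| < 1 → evalC b x = u := by
  by_cases hs : SelfMap b
  · exact Or.inl hs
  right
  have : ∃ q : H, ‖q‖ < 1 ∧ 1 ≤ ‖evalC b q‖ := by
    by_contra hcon
    push Not at hcon
    exact hs ⟨hb.1, hcon⟩
  obtain ⟨q, hq, hq1⟩ := this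
  have hq2 : ‖evalC b q‖ = 1 := le_antisymm (hb.2 q hq) hq1
  obtain ⟨z, v, hv, h⟩ := exists_conj q
  have hz : ‖z‖ < 1 := by rw [← norm_conj hv h]; exact hq
  refine ⟨evalC b q, hq2, fun x hx => ?_⟩
  have hd : DifferentiableOn ℂ (fun z => opF b z v) (ball 0 1) := by
    intro z hz
    exact (opF_diff hb.1 z hz).clm_apply (differentiableWithinAt_const _)
  have hq3 : ‖opF b z v‖ = ‖v‖ := by rw [opF_apply hb.1 hz h hv, norm_mul, hq2, mul_one]
  have hmax : IsMaxOn (norm ∘ fun z => opF b z v) (ball 0 1) z := by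
    intro y hy
    have := opF_le hb (z := y) (by simpa using hy) v
    simp only [mem_ofPred_eq, Function.comp]
    rw [hq3]; exact this
  have := scs
  have := Complex.eqOn_of_isPreconnected_of_isMaxOn_norm (convex_ball (0 : ℂ) 1).isPreconnected
    isOpen_ball hd (by simpa using hz) hmax (x := (x : ℂ)) (by simpa using hx)
  simp only [Function.const] at this
  rw [opF_real hb.1 hx, opF_apply hb.1 hz h hv] at this
  exact mul_left_cancel₀ hv this

/-- Möbius transformation of operators -/
def Mob (w : H) (F : H →L[ℂ] H) : H →L[ℂ] H :=
  (F - Rm w) * Ring.inverse (1 - Rm (star w) * F)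

lemma op_norm_le {F : H →L[ℂ] H} (hF : ∀ v, ‖F v‖ ≤ ‖v‖) : ‖F‖ ≤ 1 :=
  F.opNorm_le_bound zero_le_one (fun v => by rw [one_mul]; exact hF v)

lemma mob_unit {w : H} (hw : ‖w‖ < 1) {F : H →L[ℂ] H} (hF : ∀ v, ‖F v‖ ≤ ‖v‖) :
    IsUnit (1 - Rm (star w) * F) := by
  apply isUnit_one_sub_of_norm_lt_one
  calc ‖Rm (star w) * F‖ ≤ ‖Rm (star w)‖ * ‖F‖ := norm_mul_le _ _
    _ ≤ ‖w‖ * 1 := by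
      gcongr
      · exact (Rm_norm _).trans (by rw [Quaternion.norm_star])
      · exact op_norm_le hF
    _ < 1 := by simpa using hw

lemma mob_key {w : H} (hw : ‖w‖ < 1) {F : H →L[ℂ] H} (hF : ∀ v, ‖F v‖ ≤ ‖v‖) (v : H) :
    Mob w F (v - F v * star w) = F v - v * w := by
  have h1 := Ring.inverse_mul_cancel _ (mob_unit hw hF)
  have h2 : Mob w F * (1 - Rm (star w) * F) = F - Rm w := by
    rw [Mob, mul_assoc, h1, mul_one]
  have h3 := congrArg (fun T : H →L[ℂ] H => T v) h2
  exact h3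

lemma mob_surj {w : H} (hw : ‖w‖ < 1) {F : H →L[ℂ] H} (hF : ∀ v, ‖F v‖ ≤ ‖v‖) (v : H) :
    ∃ u, v = u - F u * star w := by
  have h1 := Ring.mul_inverse_cancel _ (mob_unit hw hF)
  have h3 := congrArg (fun T : H →L[ℂ] H => T v) h1
  exact ⟨Ring.inverse (1 - Rm (star w) * F) v, h3.symm⟩

lemma nsq (a : H) : ‖a‖ ^ 2 = a.re ^ 2 + a.imI ^ 2 + a.imJ ^ 2 + a.imK ^ 2 := by
  rw [sq, ← Quaternion.normSq_eq_norm_mul_self, Quaternion.normSq_def']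

lemma mob_id (u p w : H) : ‖u - p * star w‖ ^ 2 - ‖p - u * w‖ ^ 2
    = (1 - ‖w‖ ^ 2) * (‖u‖ ^ 2 - ‖p‖ ^ 2) := by
  simp only [nsq]
  simp
  ring

lemma mob_le {w : H} (hw : ‖w‖ < 1) {F : H →L[ℂ] H} (hF : ∀ v, ‖F v‖ ≤ ‖v‖) (v : H) :
    ‖Mob w F v‖ ≤ ‖v‖ := by
  obtain ⟨u, rfl⟩ := mob_surj hw hF v
  rw [mob_key hw hF]
  have h := mob_id u (F u) w
  have h1 : ‖F u‖ ^ 2 ≤ ‖u‖ ^ 2 := by gcongr; exact hF u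
  have h2 : ‖w‖ ^ 2 < 1 := by nlinarith [norm_nonneg w]
  refine le_of_sq_le_sq ?_ (norm_nonneg _)
  nlinarith

lemma mob_lt {w : H} (hw : ‖w‖ < 1) {F : H →L[ℂ] H} (hF : ∀ v ≠ 0, ‖F v‖ < ‖v‖) {v : H}
    (hv : v ≠ 0) : ‖Mob w F v‖ < ‖v‖ := by
  have hF' : ∀ v, ‖F v‖ ≤ ‖v‖ := fun v => by
    by_cases h : v = 0
    · simp [h]
    · exact (hF v h).le
  obtain ⟨u, rfl⟩ := mob_surj hw hF' v
  have hu : u ≠ 0 := by rintro rfl; simp at hv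
  rw [mob_key hw hF']
  have h := mob_id u (F u) w
  have h1 : ‖F u‖ ^ 2 < ‖u‖ ^ 2 := by gcongr; exact hF u hu
  have h2 : ‖w‖ ^ 2 < 1 := by nlinarith [norm_nonneg w]
  refine lt_of_pow_lt_pow_left₀ 2 (norm_nonneg _) ?_
  nlinarith [mul_pos (sub_pos.2 h2) (sub_pos.2 h1)]

lemma mob_symm {w : H} (hw : ‖w‖ < 1) {F F' : H →L[ℂ] H} (hF : ∀ v, ‖F v‖ ≤ ‖v‖)
    (hF' : ∀ v, ‖F' v‖ ≤ ‖v‖) (h : ∀ v, F' (jj * v) = jj * F v) (v : H) :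
    Mob w F' (jj * v) = jj * Mob w F v := by
  obtain ⟨u, rfl⟩ := mob_surj hw hF v
  rw [mob_key hw hF]
  have := mob_key hw hF' (jj * u)
  rw [h] at this
  rw [mul_sub, mul_sub, ← mul_assoc, ← mul_assoc, this]

lemma mob_OS {w : H} (hw : ‖w‖ < 1) {F : ℂ → H →L[ℂ] H} (hF : OS F) :
    OS (fun z => Mob w (F z)) := by
  refine ⟨?_, ?_, ?_⟩
  · have h1 : DifferentiableOn ℂ (fun z => (F z - Rm w)) (ball 0 1) :=
      hF.diff.sub (differentiableOn_const _)
    have h2 : DifferentiableOn ℂ (fun z => 1 - Rm (star w) * F z) (ball 0 1) :=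
      (differentiableOn_const _).sub ((differentiableOn_const _).mul hF.diff)
    exact h1.mul (h2.inverse fun z hz => mob_unit hw (hF.le z (by simpa using hz)))
  · intro z hz v
    exact mob_symm hw (hF.le z hz) (hF.le _ (by simpa using hz)) (hF.symm z hz) v
  · intro z hz v
    exact mob_le hw (hF.le z hz) v

lemma sm_apply (c : ℂ) (T : H →L[ℂ] H) (v : H) : (c • T) v = c • T v := rfl

/-- complex Blaschke factor with real zero -/
def bl (r : ℝ) (z : ℂ) : ℂ := (z - r) / (1 - r * z)

lemma bl_den {r : ℝ} (hr : |r| < 1) {z : ℂ} (hz : ‖z‖ < 1) : (1 - (r : ℂ) * z) ≠ 0 := by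
  intro h
  have h1 : (r : ℂ) * z = 1 := (sub_eq_zero.1 h).symm
  have h2 := congrArg norm h1
  rw [norm_mul, norm_one, Complex.norm_real, Real.norm_eq_abs] at h2
  nlinarith [abs_nonneg r, norm_nonneg z]

lemma bl_lt {r : ℝ} (hr : |r| < 1) {z : ℂ} (hz : ‖z‖ < 1) : ‖bl r z‖ < 1 := by
  rw [bl, norm_div, div_lt_one (norm_pos_iff.2 (bl_den hr hz))]
  refine lt_of_pow_lt_pow_left₀ 2 (norm_nonneg _) ?_
  rw [← Complex.normSq_eq_norm_sq, ← Complex.normSq_eq_norm_sq, Complex.normSq_apply,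
    Complex.normSq_apply]
  have h1 : z.re * z.re + z.im * z.im < 1 := by
    rw [← Complex.normSq_apply, Complex.normSq_eq_norm_sq]
    nlinarith [norm_nonneg z]
  have h2 : r ^ 2 < 1 := by rw [← sq_abs]; nlinarith [abs_nonneg r]
  simp
  nlinarith [mul_pos (sub_pos.2 h1) (sub_pos.2 h2)]

lemma bl_diff {r : ℝ} (hr : |r| < 1) : DifferentiableOn ℂ (bl r) (ball 0 1) := by
  unfold bl
  refine DifferentiableOn.div (by fun_prop) (by fun_prop) ?_
  intro z hz
  exact bl_den hr (by simpa using hz)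

lemma bl_conj (r : ℝ) (z : ℂ) : bl r (starRingEnd ℂ z) = starRingEnd ℂ (bl r z) := by
  simp [bl]

lemma jj_smul (z : ℂ) (v : H) : (starRingEnd ℂ z) • (jj * v) = jj * (z • v) := by
  rw [csmul_def, csmul_def, ← mul_assoc, ← mul_assoc, jj_mul]

lemma mob_alg {g w a : H} (hg : ‖g‖ ≤ 1) (hw : ‖w‖ < 1) (h : (1 + g * star w) * a = g + w) :
    (1 - a * star w) * g = a - w := by
  have hne : (1 + g * star w) ≠ 0 := by
    intro h0
    have h1 : g * star w = -1 := by rw [eq_neg_iff_add_eq_zero, add_comm]; exact h0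
    have h2 := congrArg norm h1
    rw [norm_mul, Quaternion.norm_star, norm_neg, norm_one] at h2
    nlinarith [norm_nonneg g, norm_nonneg w]
  apply mul_left_cancel₀ hne
  have hc : w * star w * g = g * (star w * w) := by
    rw [Quaternion.self_mul_star, Quaternion.star_mul_self]
    exact Quaternion.coe_commutes _ _
  have e1 : (1 + g * star w) * ((1 - a * star w) * g)
      = g + g * star w * g - (1 + g * star w) * a * star w * g := by noncomm_ring
  have e2 : (1 + g * star w) * (a - w) = (1 + g * star w) * a - w - g * star w * w := by
    noncomm_ring
  rw [e1, e2, h, add_mul, add_mul, hc]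
  noncomm_ring

lemma up {b : ℕ → H} (hb : SB b) {w : H} (hw : ‖w‖ < 1) {r : ℝ} (hr : |r| < 1) :
    ∃ a, SelfMap a ∧ ∀ x : ℝ, |x| < 1 →
      (1 - evalC a x * star w) * ((bl r x : H) * evalC b x) = evalC a x - w := by
  have hB := opF_OS hb
  have hlt : ∀ z : ℂ, ‖z‖ < 1 → ∀ v ≠ 0, ‖(bl r z • opF b z) v‖ < ‖v‖ := by
    intro z hz v hv
    rw [sm_apply, norm_smul]
    have h1 := hB.le z hz v
    have h2 := bl_lt hr hz
    have h3 := norm_pos_iff.2 hv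
    nlinarith [norm_nonneg (bl r z), norm_nonneg (opF b z v)]
  have hG : OS (fun z => bl r z • opF b z) := by
    refine ⟨(bl_diff hr).smul hB.diff, ?_, ?_⟩
    · intro z hz v
      rw [sm_apply, sm_apply, hB.symm z hz, bl_conj,
        jj_smul]
    · intro z hz v
      by_cases hv : v = 0
      · simp [hv]
      · exact (hlt z hz v hv).le
  have hw' : ‖-w‖ < 1 := by rwa [norm_neg]
  have hM := mob_OS hw' hG
  obtain ⟨a, _, ha2, ha3⟩ := fromOS hM
  refine ⟨a, ha3 fun z hz v hv => mob_lt hw' (hlt z hz) hv, fun x hx => ?_⟩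
  have hx' : ‖(x : ℂ)‖ < 1 := by simpa using hx
  have k := mob_key hw' (hG.le x hx') 1
  have k1 := hM.real hx (1 - (bl r x • opF b x) 1 * star (-w))
  rw [k1, ← ha2 x hx, sm_apply, opF_real hb.1 hx, one_mul, csmul_def,
    star_neg, mul_neg, sub_neg_eq_add, mul_neg, sub_neg_eq_add, one_mul] at k
  refine mob_alg ?_ hw k
  rw [norm_mul, norm_cc]
  have h1 := hb.2 x (by simpa using hx)
  have h2 := bl_lt hr hx'
  nlinarith [norm_nonneg (bl r x), norm_nonneg (evalC b x)]

lemma bl_inv {r : ℝ} (hr : |r| < 1) {z : ℂ} (hz : ‖z‖ < 1) : bl (-r) (bl r z) = z := by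
  have h1 := bl_den hr hz
  have hr1 : (1 - (r : ℂ) * r) ≠ 0 := bl_den hr (z := (r : ℂ)) (by simpa using hr)
  have e1 : bl r z * (1 - r * z) = z - r := div_mul_cancel₀ _ h1
  have hb : ‖bl r z‖ < 1 := bl_lt hr hz
  have h2 : 1 - ((-r : ℝ) : ℂ) * bl r z ≠ 0 := bl_den (by rwa [abs_neg]) hb
  rw [bl, div_eq_iff h2]
  push_cast
  linear_combination e1

lemma down {a : ℕ → H} (ha : SelfMap a) {r : ℝ} (hr : |r| < 1) :
    ∃ b, SB b ∧ ∀ x : ℝ, |x| < 1 →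
      (1 - evalC a x * star (evalC a r)) * ((bl r x : H) * evalC b x)
        = evalC a x - evalC a r := by
  set w := evalC a r with hwdef
  have hw : ‖w‖ < 1 := ha.2 r (by simpa using hr)
  have hA := opF_OS ha.sb
  have hM := mob_OS hw hA
  set M : ℂ → H →L[ℂ] H := fun z => Mob w (opF a z) with hMdef
  have hrb : ‖(r : ℂ)‖ < 1 := by simpa using hr
  have hxr : ∀ x : ℝ, |x| < 1 → (1 - evalC a x * star w) * M x 1 = evalC a x - w := by
    intro x hx
    have hx' : ‖(x : ℂ)‖ < 1 := by simpa using hx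
    have k := mob_key hw (hA.le x hx') 1
    have k1 := hM.real hx (1 - (opF a x) 1 * star w)
    have k2 : M x (1 - (opF a x) 1 * star w) = (opF a x) 1 - 1 * w := k
    rw [k1, opF_real ha.1 hx, one_mul, one_mul] at k2
    exact k2
  have hM1 : M r 1 = 0 := by
    have h := hxr r hr
    rw [← hwdef, sub_self] at h
    rcases mul_eq_zero.1 h with h | h
    · exfalso
      have h2 := congrArg norm (sub_eq_zero.1 h)
      rw [norm_mul, Quaternion.norm_star, norm_one] at h2
      nlinarith [norm_nonneg w]
    · exact h
  have hMr : ∀ v, M r v = 0 := by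
    intro v
    rw [hM.real hr, hM1, mul_zero]
  have hMr0 : M r = 0 := by ext1 v; exact hMr v
  have hschw : ∀ z : ℂ, ‖z‖ < 1 → ∀ v, ‖M z v‖ ≤ ‖bl r z‖ * ‖v‖ := by
    intro z hz v
    have hr' : |-r| < 1 := by rwa [abs_neg]
    have hmap : MapsTo (bl (-r)) (ball 0 1) (ball 0 1) := by
      intro y hy
      have := bl_lt hr' (z := y) (by simpa using hy)
      simpa using this
    have hd : DifferentiableOn ℂ (fun y => M (bl (-r) y) v) (ball 0 1) := by
      have h1 : DifferentiableOn ℂ (fun y => M (bl (-r) y)) (ball 0 1) :=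
        hM.diff.comp (bl_diff hr') hmap
      intro y hy
      exact (h1 y hy).clm_apply (differentiableWithinAt_const _)
    have h0 : bl (-r) 0 = r := by simp [bl]
    have hmaps : MapsTo (fun y => M (bl (-r) y) v) (ball 0 1)
        (closedBall ((fun y => M (bl (-r) y) v) 0) ‖v‖) := by
      intro y hy
      simp only [h0, hMr]
      rw [mem_closedBall_zero_iff]
      exact hM.le _ (by simpa using hmap hy) v
    have hb : bl r z ∈ ball (0 : ℂ) 1 := by simpa using bl_lt hr hz
    have := Complex.dist_le_div_mul_dist_of_mapsTo_ball hd hmaps hb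
    simp only [h0, hMr, bl_inv hr hz, dist_zero_right, div_one] at this
    rw [mul_comm]
    exact this
  set G : ℂ → H →L[ℂ] H := fun z => (1 - (r : ℂ) * z) • dslope M r z with hG
  have hGne : ∀ z : ℂ, ‖z‖ < 1 → z ≠ r → bl r z • G z = M z := by
    intro z hz hzr
    have h1 := bl_den hr hz
    have h2 : z - r ≠ 0 := sub_ne_zero.2 hzr
    simp only [hG]
    rw [dslope_of_ne _ hzr, slope_def_module, hMr0, sub_zero, smul_smul, smul_smul, bl]
    have : (z - r) / (1 - r * z) * (1 - r * z) * (z - r)⁻¹ = 1 := by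
      rw [div_mul_cancel₀ _ h1, mul_inv_cancel₀ h2]
    rw [this, one_smul]
  have hGd : DifferentiableOn ℂ G (ball 0 1) := by
    have : DifferentiableOn ℂ (dslope M r) (ball 0 1) :=
      (Complex.differentiableOn_dslope (isOpen_ball.mem_nhds (by simpa using hr))).2 hM.diff
    have h1 : DifferentiableOn ℂ (fun z : ℂ => 1 - (r : ℂ) * z) (ball 0 1) := by fun_prop
    exact h1.smul this
  clear_value G
  have hblne : ∀ z : ℂ, ‖z‖ < 1 → z ≠ r → bl r z ≠ 0 := by
    intro z hz hzr
    exact div_ne_zero (sub_ne_zero.2 hzr) (bl_den hr hz)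
  have hnear : ∀ᶠ z : ℂ in 𝓝[≠] (r : ℂ), ‖z‖ < 1 ∧ z ≠ r := by
    have h1 : ∀ᶠ z : ℂ in 𝓝[≠] (r : ℂ), ‖z‖ < 1 :=
      nhdsWithin_le_nhds ((isOpen_lt continuous_norm continuous_const).mem_nhds hrb)
    exact h1.and self_mem_nhdsWithin
  have hGc : ContinuousAt G r :=
    (hGd.differentiableAt (isOpen_ball.mem_nhds (by simpa using hr))).continuousAt
  have hle1 : ∀ z : ℂ, ‖z‖ < 1 → z ≠ r → ∀ v, ‖G z v‖ ≤ ‖v‖ := by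
    intro z hz hzr v
    have h := hschw z hz v
    rw [← hGne z hz hzr, sm_apply, norm_smul] at h
    exact le_of_mul_le_mul_left h (norm_pos_iff.2 (hblne z hz hzr))
  have hsymm1 : ∀ z : ℂ, ‖z‖ < 1 → z ≠ r → ∀ v,
      G (starRingEnd ℂ z) (jj * v) = jj * G z v := by
    intro z hz hzr v
    have hz' : ‖starRingEnd ℂ z‖ < 1 := by simpa using hz
    have hzr' : starRingEnd ℂ z ≠ r := by
      intro h
      apply hzr
      rw [← starRingEnd_self_apply z, h, Complex.conj_ofReal]
    have h := hM.symm z hz v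
    rw [← hGne z hz hzr, ← hGne _ hz' hzr', sm_apply,
      sm_apply, bl_conj, ← jj_smul] at h
    refine smul_right_injective H ?_ h
    rw [← bl_conj]
    exact hblne _ hz' hzr'
  have hOS : OS G := by
    refine ⟨hGd, ?_, ?_⟩
    · intro z hz v
      by_cases hzr : z = r
      · subst hzr
        have hcj : Tendsto (fun z : ℂ => starRingEnd ℂ z) (𝓝 (r : ℂ)) (𝓝 (r : ℂ)) := by
          have := Complex.continuous_conj.tendsto (r : ℂ)
          simpa using this
        have t1 : Tendsto (fun z : ℂ => G (starRingEnd ℂ z) (jj * v)) (𝓝[≠] (r : ℂ))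
            (𝓝 (G r (jj * v))) := by
          have := ((ContinuousLinearMap.apply ℂ H (jj * v)).continuous.tendsto _).comp
            (hGc.tendsto.comp hcj)
          exact this.mono_left nhdsWithin_le_nhds
        have t2 : Tendsto (fun z : ℂ => jj * G z v) (𝓝[≠] (r : ℂ)) (𝓝 (jj * G r v)) := by
          have := ((ContinuousLinearMap.apply ℂ H v).continuous.tendsto _).comp hGc.tendsto
          exact (this.const_mul jj).mono_left nhdsWithin_le_nhds
        rw [Complex.conj_ofReal]
        refine tendsto_nhds_unique_of_eventuallyEq t1 t2 ?_
        filter_upwards [hnear] with y hy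
        exact hsymm1 y hy.1 hy.2 v
      · exact hsymm1 z hz hzr v
    · intro z hz v
      by_cases hzr : z = r
      · subst hzr
        have t2 : Tendsto (fun z : ℂ => ‖G z v‖) (𝓝[≠] (r : ℂ)) (𝓝 ‖G r v‖) := by
          have := ((ContinuousLinearMap.apply ℂ H v).continuous.tendsto _).comp hGc.tendsto
          exact this.norm.mono_left nhdsWithin_le_nhds
        refine le_of_tendsto t2 ?_
        filter_upwards [hnear] with y hy
        exact hle1 y hy.1 hy.2 v
      · exact hle1 z hz hzr v
  obtain ⟨b, hb1, hb2, _⟩ := fromOS hOS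
  refine ⟨b, hb1, fun x hx => ?_⟩
  rw [← hxr x hx, hb2 x hx]
  congr 1
  by_cases hxr' : x = r
  · subst hxr'
    rw [hM1]
    simp [bl]
  · rw [← csmul_def, ← sm_apply, hGne x (by simpa using hx)]
    exact_mod_cast hxr'

end Aux

/-- real Blaschke factor -/
def bt (r x : ℝ) : ℝ := (x - r) / (1 - r * x)

lemma bl_bt (r x : ℝ) : ((bl r x : ℂ) : H) = (bt r x : H) := by
  rw [← Quaternion.coeComplex_coe]
  congr 1
  simp [bl, bt]

lemma bt_den {r x : ℝ} (hr : |r| < 1) (hx : |x| < 1) : 1 - r * x ≠ 0 := by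
  intro h
  have h2 := congrArg abs (sub_eq_zero.1 h).symm
  rw [abs_mul, abs_one] at h2
  nlinarith [abs_nonneg r, abs_nonneg x]

lemma bt_ne {r x : ℝ} (hr : |r| < 1) (hx : |x| < 1) (h : r ≠ x) : bt r x ≠ 0 :=
  div_ne_zero (sub_ne_zero.2 h.symm) (bt_den hr hx)

lemma bt_neH {r x : ℝ} (hr : |r| < 1) (hx : |x| < 1) (h : r ≠ x) : (bt r x : H) ≠ 0 := by
  intro h0
  apply bt_ne hr hx h
  have h1 := congrArg norm h0
  rw [Quaternion.norm_coe, norm_zero, norm_eq_zero] at h1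
  exact h1

lemma bt_form (r x : ℝ) : (1 - (x : H) * (r : H))⁻¹ * ((x : H) - (r : H)) = (bt r x : H) := by
  have : bt r x = (1 - x * r)⁻¹ * (x - r) := by rw [bt, div_eq_inv_mul, mul_comm x r]
  rw [this]
  push_cast
  rfl

lemma rho_real (r x : ℝ) : rho (r : H) (x : H) = |bt r x| := by
  rw [rho, mobiusM, Quaternion.star_coe, bt_form, Quaternion.norm_coe, Real.norm_eq_abs]

lemma mM_den {w a : H} (hw : ‖w‖ < 1) (ha : ‖a‖ < 1) : 1 - a * star w ≠ 0 := by
  intro h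
  have h2 := congrArg norm (sub_eq_zero.1 h).symm
  rw [norm_mul, norm_one, Quaternion.norm_star] at h2
  nlinarith [norm_nonneg a, norm_nonneg w]

lemma mM_eq {w a g : H} (hw : ‖w‖ < 1) (ha : ‖a‖ < 1) (h : (1 - a * star w) * g = a - w) :
    mobiusM w a = g := by
  rw [mobiusM, ← h, ← mul_assoc, inv_mul_cancel₀ (mM_den hw ha), one_mul]

lemma mM_spec {w a : H} (hw : ‖w‖ < 1) (ha : ‖a‖ < 1) :
    (1 - a * star w) * mobiusM w a = a - w := by
  rw [mobiusM, ← mul_assoc, mul_inv_cancel₀ (mM_den hw ha), one_mul]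

lemma mM_inj {w a b : H} (hw : ‖w‖ < 1) (ha : ‖a‖ < 1) (hb : ‖b‖ < 1)
    (h : mobiusM w a = mobiusM w b) : a = b := by
  have h1 := mM_spec hw ha
  have h2 := mM_spec hw hb
  rw [h] at h1
  set g := mobiusM w b
  have h3 : a * (1 + star w * g) = g + w := by
    have : a * (1 + star w * g) = a - ((1 - a * star w) * g) + g := by noncomm_ring
    rw [this, h1]; abel
  have h4 : b * (1 + star w * g) = g + w := by
    have : b * (1 + star w * g) = b - ((1 - b * star w) * g) + g := by noncomm_ring
    rw [this, h2]; abel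
  by_cases h0 : 1 + star w * g = 0
  · exfalso
    rw [h0, mul_zero] at h3
    have h5 : g = -w := eq_neg_of_add_eq_zero_left h3.symm
    rw [h5, mul_neg, ← sub_eq_add_neg] at h0
    have h2 := congrArg norm (sub_eq_zero.1 h0).symm
    rw [norm_mul, norm_one, Quaternion.norm_star] at h2
    nlinarith [norm_nonneg w]
  · exact mul_right_cancel₀ h0 (h3.trans h4.symm)

lemma mM_self (w : H) : mobiusM w w = 0 := by simp [mobiusM]

/-- one Schur step -/
def Rel (r : ℝ) (w : H) (a b : ℕ → H) : Prop :=
  ∀ x : ℝ, |x| < 1 → mobiusM w (evalC a x) = (bt r x : H) * evalC b x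

lemma SelfMap.at {a : ℕ → H} (ha : SelfMap a) {x : ℝ} (hx : |x| < 1) : ‖evalC a x‖ < 1 :=
  ha.2 x (by simpa using hx)

lemma up' {b : ℕ → H} (hb : SB b) {w : H} (hw : ‖w‖ < 1) {r : ℝ} (hr : |r| < 1) :
    ∃ a, SelfMap a ∧ Rel r w a b := by
  obtain ⟨a, ha, h⟩ := up hb hw hr
  refine ⟨a, ha, fun x hx => ?_⟩
  have := h x hx
  rw [bl_bt] at this
  exact mM_eq hw (ha.at hx) this

lemma down' {a : ℕ → H} (ha : SelfMap a) {r : ℝ} (hr : |r| < 1) {w : H} (hw : evalC a r = w) :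
    ∃ b, SB b ∧ Rel r w a b := by
  obtain ⟨b, hb, h⟩ := down ha hr
  refine ⟨b, hb, fun x hx => ?_⟩
  have := h x hx
  rw [bl_bt, hw] at this
  exact mM_eq (hw ▸ ha.at hr) (ha.at hx) this

lemma Rel.det {r : ℝ} {w : H} (hw : ‖w‖ < 1) {a a' b b' : ℕ → H} (ha : SelfMap a)
    (ha' : SelfMap a') (h : Rel r w a b) (h' : Rel r w a' b')
    (e : ∀ x : ℝ, |x| < 1 → evalC b x = evalC b' x) : a = a' := by
  refine uniq ha.1 ha'.1 fun x hx => ?_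
  refine mM_inj hw (ha.at hx) (ha'.at hx) ?_
  rw [h x hx, h' x hx, e x hx]

lemma Rel.val {r : ℝ} (hr : |r| < 1) {w : H} {a b : ℕ → H} (h : Rel r w a b) {y : ℝ}
    (hy : |y| < 1) (hry : r ≠ y) : evalC b y = (bt r y : H)⁻¹ * mobiusM w (evalC a y) := by
  rw [h y hy, ← mul_assoc, inv_mul_cancel₀ (bt_neH hr hy hry), one_mul]

lemma Rel.node {r : ℝ} (hr : |r| < 1) {w : H} (hw : ‖w‖ < 1) {a b : ℕ → H} (ha : SelfMap a)
    (h : Rel r w a b) : evalC a r = w := by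
  refine mM_inj hw (ha.at hr) hw ?_
  rw [h r hr, mM_self]
  simp [bt]

lemma Rel.other {r : ℝ} (hr : |r| < 1) {w : H} (hw : ‖w‖ < 1) {a b : ℕ → H} (ha : SelfMap a)
    (h : Rel r w a b) {y : ℝ} (hy : |y| < 1) (hry : r ≠ y) {s : H} (hs : ‖s‖ < 1)
    (e : evalC b y = (bt r y : H)⁻¹ * mobiusM w s) : evalC a y = s := by
  refine mM_inj hw (ha.at hy) hs ?_
  rw [h y hy, e, ← mul_assoc, mul_inv_cancel₀ (bt_neH hr hy hry), one_mul]

lemma const_det {b b' : ℕ → H} (hb : SB b) (hb' : SB b') {y : ℝ} (hy : |y| < 1)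
    (h1 : 1 ≤ ‖evalC b y‖) (e : evalC b y = evalC b' y) :
    ∀ x : ℝ, |x| < 1 → evalC b x = evalC b' x := by
  intro x hx
  rcases dich hb with h | ⟨u, -, hu⟩
  · exact absurd (h.at hy) (not_lt.2 h1)
  rcases dich hb' with h | ⟨u', -, hu'⟩
  · exact absurd (h.at hy) (not_lt.2 (e ▸ h1))
  rw [hu x hx, hu' x hx, ← hu y hy, ← hu' y hy, e]

lemma SB.selfMap {b : ℕ → H} (hb : SB b) {y : ℝ} (hy : |y| < 1) (h : ‖evalC b y‖ < 1) :
    SelfMap b := by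
  rcases dich hb with h' | ⟨u, hu1, hu⟩
  · exact h'
  · rw [hu y hy, hu1] at h
    exact absurd h (lt_irrefl _)

/-- constant series -/
def cst (p : H) : ℕ → H := fun m => if m = 0 then p else 0

lemma cst_hasSum (p q : H) : HasSum (fun m => q ^ m * cst p m) p := by
  have := hasSum_ite_eq (0 : ℕ) p
  convert this using 2 with m
  by_cases h : m = 0 <;> simp [cst, h]

lemma cst_eval (p q : H) : evalC (cst p) q = p := (cst_hasSum p q).tsum_eq

lemma cst_SB {p : H} (hp : ‖p‖ ≤ 1) : SB (cst p) :=
  ⟨fun q _ => (cst_hasSum p q).summable, fun q _ => by rw [cst_eval]; exact hp⟩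

lemma norm_Q {r x : ℝ} (hr : |r| < 1) (hx : |x| < 1) (h : r ≠ x) (s t : H) :
    ‖(bt r x : H)⁻¹ * mobiusM s t‖ < 1 ↔ rho s t < rho (r : H) (x : H) := by
  rw [rho_real, norm_mul, norm_inv, Quaternion.norm_coe, Real.norm_eq_abs,
    inv_mul_lt_iff₀ (abs_pos.2 (bt_ne hr hx h)), mul_one, rho]

lemma norm_Q_eq {r x : ℝ} (hr : |r| < 1) (hx : |x| < 1) (h : r ≠ x) (s t : H)
    (e : rho s t = rho (r : H) (x : H)) : ‖(bt r x : H)⁻¹ * mobiusM s t‖ = 1 := by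
  rw [rho_real] at e
  rw [norm_mul, norm_inv, Quaternion.norm_coe, Real.norm_eq_abs]
  change |bt r x|⁻¹ * rho s t = 1
  rw [e, inv_mul_cancel₀ (abs_pos.2 (bt_ne hr hx h)).ne']

/-- Three-point Nevanlinna–Pick interpolation with real nodes. -/
theorem nevanlinnaPick_three_points (r₁ r₂ r₃ : ℝ)
    (hr₁ : -1 < r₁ ∧ r₁ < 1) (hr₂ : -1 < r₂ ∧ r₂ < 1) (hr₃ : -1 < r₃ ∧ r₃ < 1)
    (h12 : r₁ ≠ r₂) (h13 : r₁ ≠ r₃) (h23 : r₂ ≠ r₃)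
    (s₁ s₂ s₃ : H) (hs₁ : ‖s₁‖ < 1) (hs₂ : ‖s₂‖ < 1) (hs₃ : ‖s₃‖ < 1) :
    let Q12 : H := ((1 - (r₂ : H) * (r₁ : H))⁻¹ * ((r₂ : H) - (r₁ : H)))⁻¹ *
      ((1 - s₂ * star s₁)⁻¹ * (s₂ - s₁))
    let Q13 : H := ((1 - (r₃ : H) * (r₁ : H))⁻¹ * ((r₃ : H) - (r₁ : H)))⁻¹ *
      ((1 - s₃ * star s₁)⁻¹ * (s₃ - s₁))
    ({a : ℕ → H | SelfMap a ∧ evalC a (r₁ : H) = s₁ ∧ evalC a (r₂ : H) = s₂ ∧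
        evalC a (r₃ : H) = s₃}.Infinite ↔
      (rho s₁ s₂ < rho (r₁ : H) (r₂ : H) ∧ rho s₁ s₃ < rho (r₁ : H) (r₃ : H) ∧
        rho Q12 Q13 < rho (r₂ : H) (r₃ : H))) ∧
    (rho s₁ s₂ < rho (r₁ : H) (r₂ : H) → rho s₁ s₃ < rho (r₁ : H) (r₃ : H) →
      rho Q12 Q13 = rho (r₂ : H) (r₃ : H) →
      ∃! a : ℕ → H, SelfMap a ∧ evalC a (r₁ : H) = s₁ ∧ evalC a (r₂ : H) = s₂ ∧
        evalC a (r₃ : H) = s₃) := by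
  intro Q12 Q13
  have a1 : |r₁| < 1 := abs_lt.2 hr₁
  have a2 : |r₂| < 1 := abs_lt.2 hr₂
  have a3 : |r₃| < 1 := abs_lt.2 hr₃
  have eQ12 : Q12 = (bt r₁ r₂ : H)⁻¹ * mobiusM s₁ s₂ := by
    simp only [Q12, bt_form]; rfl
  have eQ13 : Q13 = (bt r₁ r₃ : H)⁻¹ * mobiusM s₁ s₃ := by
    simp only [Q13, bt_form]; rfl
  clear_value Q12 Q13
  rw [← norm_Q a1 a2 h12, ← norm_Q a1 a3 h13, ← eQ12, ← eQ13, ← norm_Q a2 a3 h23]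
  have hPeq := norm_Q_eq a2 a3 h23 Q12 Q13
  set P := (bt r₂ r₃ : H)⁻¹ * mobiusM Q12 Q13 with hP
  -- descent
  have desc : ∀ a : ℕ → H, (SelfMap a ∧ evalC a (r₁ : H) = s₁ ∧ evalC a (r₂ : H) = s₂ ∧
      evalC a (r₃ : H) = s₃) → ∃ b, SB b ∧ Rel r₁ s₁ a b ∧ evalC b r₂ = Q12 ∧
      evalC b r₃ = Q13 := by
    rintro a ⟨ha, e1, e2, e3⟩
    obtain ⟨b, hb, hR⟩ := down' ha a1 e1
    refine ⟨b, hb, hR, ?_, ?_⟩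
    · rw [hR.val a1 a2 h12, e2, eQ12]
    · rw [hR.val a1 a3 h13, e3, eQ13]
  have desc2 : ‖Q12‖ < 1 → ∀ b : ℕ → H, SB b → evalC b r₂ = Q12 → evalC b r₃ = Q13 →
      SelfMap b ∧ ∃ c, SB c ∧ Rel r₂ Q12 b c ∧ evalC c r₃ = P := by
    intro hQ b hb e2 e3
    have hb' : SelfMap b := hb.selfMap a2 (by rw [e2]; exact hQ)
    obtain ⟨c, hc, hR⟩ := down' hb' a2 e2
    refine ⟨hb', c, hc, hR, ?_⟩
    rw [hR.val a2 a3 h23, e3, hP]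
  have asc : ‖Q12‖ < 1 → ‖Q13‖ < 1 → ∀ c, SB c → evalC c r₃ = P →
      ∃ b a, SelfMap b ∧ Rel r₂ Q12 b c ∧ Rel r₁ s₁ a b ∧
        (SelfMap a ∧ evalC a (r₁ : H) = s₁ ∧ evalC a (r₂ : H) = s₂ ∧ evalC a (r₃ : H) = s₃) := by
    intro q2 q3 c hc e
    obtain ⟨b, hb, hR⟩ := up' hc q2 a2
    obtain ⟨a, ha, hR'⟩ := up' hb.sb hs₁ a1
    refine ⟨b, a, hb, hR, hR', ha, hR'.node a1 hs₁ ha, ?_, ?_⟩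
    · exact hR'.other a1 hs₁ ha a2 h12 hs₂ (by rw [hR.node a2 q2 hb, eQ12])
    · refine hR'.other a1 hs₁ ha a3 h13 hs₃ ?_
      rw [hR.other a2 q2 hb a3 h23 q3 (by rw [e, hP]), eQ13]
  have sub2 : ‖Q12‖ < 1 → 1 ≤ ‖P‖ → {a : ℕ → H | SelfMap a ∧ evalC a (r₁ : H) = s₁ ∧
      evalC a (r₂ : H) = s₂ ∧ evalC a (r₃ : H) = s₃}.Subsingleton := by
    intro q2 hp a ha a' ha'
    obtain ⟨b, hb, hR, e2, e3⟩ := desc a ha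
    obtain ⟨b', hb', hR', e2', e3'⟩ := desc a' ha'
    obtain ⟨hbs, c, hc, hRc, ec⟩ := desc2 q2 b hb e2 e3
    obtain ⟨hbs', c', hc', hRc', ec'⟩ := desc2 q2 b' hb' e2' e3'
    have hbb : b = b' := hRc.det q2 hbs hbs' hRc'
      (const_det hc hc' a3 (by rw [ec]; exact hp) (by rw [ec, ec']))
    exact hR.det hs₁ ha.1 ha'.1 hR' (fun x _ => by rw [hbb])
  refine ⟨⟨fun hinf => ?_, fun ⟨q2, q3, hp⟩ => ?_⟩, fun q2 q3 hp => ?_⟩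
  · have hns := fun h : Set.Subsingleton _ => hinf h.finite
    have q2 : ‖Q12‖ < 1 := by
      by_contra hcon
      apply hns
      intro a ha a' ha'
      obtain ⟨b, hb, hR, e2, e3⟩ := desc a ha
      obtain ⟨b', hb', hR', e2', e3'⟩ := desc a' ha'
      exact hR.det hs₁ ha.1 ha'.1 hR'
        (const_det hb hb' a2 (by rw [e2]; exact not_lt.1 hcon) (by rw [e2, e2']))
    have q3 : ‖Q13‖ < 1 := by
      by_contra hcon
      apply hns
      intro a ha a' ha'
      obtain ⟨b, hb, hR, e2, e3⟩ := desc a ha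
      obtain ⟨b', hb', hR', e2', e3'⟩ := desc a' ha'
      exact hR.det hs₁ ha.1 ha'.1 hR'
        (const_det hb hb' a3 (by rw [e3]; exact not_lt.1 hcon) (by rw [e3, e3']))
    refine ⟨q2, q3, ?_⟩
    by_contra hcon
    exact hns (sub2 q2 (not_lt.1 hcon))
  · have ht : ∀ n : ℕ, ‖(((1 / ((n : ℝ) + 1) : ℝ)) : H)‖ ≤ 1 := by
      intro n
      rw [Quaternion.norm_coe, Real.norm_of_nonneg (by positivity), div_le_one (by positivity)]
      have : (0 : ℝ) ≤ n := Nat.cast_nonneg n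
      linarith
    have hex : ∀ n : ℕ, ∃ c b a, Rel r₃ P c (cst ((1 / ((n : ℝ) + 1) : ℝ) : H)) ∧
        Rel r₂ Q12 b c ∧ Rel r₁ s₁ a b ∧
        (SelfMap a ∧ evalC a (r₁ : H) = s₁ ∧ evalC a (r₂ : H) = s₂ ∧
          evalC a (r₃ : H) = s₃) := by
      intro n
      obtain ⟨c, hc, hR⟩ := up' (cst_SB (ht n)) hp a3
      obtain ⟨b, a, -, h2, h3, h4⟩ := asc q2 q3 c hc.sb (hR.node a3 hp hc)
      exact ⟨c, b, a, hR, h2, h3, h4⟩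
    choose c b a hc hb ha hsol using hex
    refine Set.infinite_of_injective_forall_mem (f := a) ?_ hsol
    intro n m hnm
    obtain ⟨x, hx, hxn⟩ := (Set.Ioo_infinite (show (-1 : ℝ) < 1 by norm_num)).exists_notMem_finset
      {r₁, r₂, r₃}
    have hx1 : |x| < 1 := abs_lt.2 hx
    simp only [Finset.mem_insert, Finset.mem_singleton, not_or] at hxn
    obtain ⟨n1, n2, n3⟩ := hxn
    have e1 : evalC (b n) x = evalC (b m) x := by
      rw [(ha n).val a1 hx1 (Ne.symm n1), (ha m).val a1 hx1 (Ne.symm n1), hnm]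
    have e2 : evalC (c n) x = evalC (c m) x := by
      rw [(hb n).val a2 hx1 (Ne.symm n2), (hb m).val a2 hx1 (Ne.symm n2), e1]
    have e3 := (hc n).val a3 hx1 (Ne.symm n3)
    rw [e2, ← (hc m).val a3 hx1 (Ne.symm n3), cst_eval, cst_eval, Quaternion.coe_inj] at e3
    have h1 : (0 : ℝ) < n + 1 := by positivity
    have h2 : (0 : ℝ) < m + 1 := by positivity
    rw [div_eq_div_iff h1.ne' h2.ne'] at e3
    have : (n : ℝ) = m := by linarith
    exact_mod_cast this
  · have hp' := hPeq hp
    obtain ⟨b, a, -, -, -, hsol⟩ := asc q2 q3 (cst P) (cst_SB hp'.le) (cst_eval _ _)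
    exact ⟨a, hsol, fun a' ha' => sub2 q2 hp'.ge ha' hsol⟩

end QPaper
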